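/- Let ξ be an extremal real number and let (W_i)_{i≥1} and (W'_i)_{i≥1} be two unbounded admissible Fibonacci sequences in 𝒫 both associated to ξ. Then there exist integers k, ℓ ≥ 0, an index i₀ ≥ 1, and a Fibonacci sequence (ε_i)_{i≥1} in the multiplicative monoid {−1, 1} such that W'_{i+k} = ε_i · W_{i+ℓ} for all i ≥ i₀. -/

import Mathlib

open Matrix

/-- 2×2 integer matrices. -/
abbrev M2 : Type := Matrix (Fin 2) (Fin 2) ℤ

/-- The content of an integer matrix: the gcd of its coefficients. -/
def content (A : M2) : ℕ :=
  Nat.gcd (Nat.gcd (A 0 0).natAbs (A 0 1).natAbs) (Nat.gcd (A 1 0).natAbs (A 1 1).natAbs)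

/-- A matrix is primitive if its content is 1. -/
def Primitive (A : M2) : Prop := content A = 1

/-- Membership in 𝒫: primitive with nonzero determinant. -/
def MemP (A : M2) : Prop := Primitive A ∧ A.det ≠ 0

/-- `A^red`: the primitive matrix such that `A = content A • A^red`. -/
def red (A : M2) : M2 := Matrix.of fun i j => A i j / (content A : ℤ)

/-- The group operation of 𝒫: `A * B = (AB)^red`. -/
def pmul (A B : M2) : M2 := red (A * B)

/-- A Fibonacci sequence in 𝒫 (indices from 1). -/
def IsFibP (W : ℕ → M2) : Prop :=
  (∀ i, 1 ≤ i → MemP (W i)) ∧ ∀ i, 1 ≤ i → W (i + 2) = pmul (W (i + 1)) (W i)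

/-- Admissibility of a Fibonacci sequence in 𝒫: there is a non-symmetric,
non-skew-symmetric N ∈ 𝒫 such that W_i N_i is symmetric for all i ≥ 1,
where N_i = ᵗN for odd i and N_i = N for even i. -/
def AdmissibleFib (W : ℕ → M2) : Prop :=
  ∃ N : M2, MemP N ∧ N ≠ Nᵀ ∧ N ≠ -Nᵀ ∧
    ∀ i, 1 ≤ i → (W i * (if i % 2 = 1 then Nᵀ else N)).IsSymm

/-- The norm of an integer 2×2 matrix: max absolute value of coefficients, as a real. -/
noncomputable def mnorm (A : M2) : ℝ :=
  max (max |(A 0 0 : ℝ)| |(A 0 1 : ℝ)|) (max |(A 1 0 : ℝ)| |(A 1 1 : ℝ)|)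

/-- The sequence is unbounded in norm. -/
def UnboundedSeq (W : ℕ → M2) : Prop := ∀ C : ℝ, ∃ i, 1 ≤ i ∧ C < mnorm (W i)

/-- The golden ratio γ = (1+√5)/2. -/
noncomputable def gam : ℝ := (1 + Real.sqrt 5) / 2

/-- Norm of the row vector (ξ, -1)·A. -/
noncomputable def xiNorm (ξ : ℝ) (A : M2) : ℝ :=
  max |ξ * (A 0 0 : ℝ) - (A 1 0 : ℝ)| |ξ * (A 0 1 : ℝ) - (A 1 1 : ℝ)|

/-- ξ is extremal: neither rational nor quadratic over ℚ, and for each X ≥ 1 the system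
|x₀| ≤ X, |x₀ξ - x₁| ≤ c X^(-1/γ), |x₀ξ² - x₂| ≤ c X^(-1/γ) has a nonzero integer solution. -/
def IsExtremal (ξ : ℝ) : Prop :=
  (∀ a b c : ℚ, ¬(a = 0 ∧ b = 0 ∧ c = 0) → (a : ℝ) * ξ ^ 2 + (b : ℝ) * ξ + (c : ℝ) ≠ 0) ∧
  ∃ c : ℝ, 0 < c ∧ ∀ X : ℝ, 1 ≤ X → ∃ x₀ x₁ x₂ : ℤ,
    ¬(x₀ = 0 ∧ x₁ = 0 ∧ x₂ = 0) ∧ |(x₀ : ℝ)| ≤ X ∧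
    |(x₀ : ℝ) * ξ - (x₁ : ℝ)| ≤ c * X ^ (-1 / gam) ∧
    |(x₀ : ℝ) * ξ ^ 2 - (x₂ : ℝ)| ≤ c * X ^ (-1 / gam)

/-- The Fibonacci sequence `W` in 𝒫 is associated to the extremal real number ξ:
it is an unbounded admissible Fibonacci sequence in 𝒫 with
‖W_{i+1}‖ ≍ ‖W_i‖^γ, ‖(ξ,-1)W_i‖ ≍ ‖W_i‖⁻¹ and |det W_i| ≍ 1. -/
def IsAssociated (ξ : ℝ) (W : ℕ → M2) : Prop :=
  IsFibP W ∧ UnboundedSeq W ∧ AdmissibleFib W ∧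
  ∃ c₁ c₂ c₃ c₄ c₅ c₆ : ℝ, 0 < c₁ ∧ 0 < c₂ ∧ 0 < c₃ ∧ 0 < c₄ ∧ 0 < c₅ ∧ 0 < c₆ ∧
    ∀ i, 1 ≤ i →
      c₁ * mnorm (W i) ^ gam ≤ mnorm (W (i + 1)) ∧
      mnorm (W (i + 1)) ≤ c₂ * mnorm (W i) ^ gam ∧
      c₃ * (mnorm (W i))⁻¹ ≤ xiNorm ξ (W i) ∧
      xiNorm ξ (W i) ≤ c₄ * (mnorm (W i))⁻¹ ∧
      c₅ ≤ |((W i).det : ℝ)| ∧ |((W i).det : ℝ)| ≤ c₆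

/-- Membership in GL₂(ℤ): integer matrix of determinant ±1. -/
def InGL2Z (A : M2) : Prop := A.det = 1 ∨ A.det = -1

/-- ξ is badly approximable: irrational and |ξ - p/q| > c/q² for all rationals p/q. -/
def BadlyApprox (ξ : ℝ) : Prop :=
  Irrational ξ ∧ ∃ c : ℝ, 0 < c ∧ ∀ p q : ℤ, q ≠ 0 → c / (q : ℝ) ^ 2 < |ξ - (p : ℝ) / (q : ℝ)|

/-- Partial quotients of the continued fraction expansion: `cfA n ξ` is `aₙ`
where ξ = [a₀, a₁, a₂, …]. -/
noncomputable def cfA : ℕ → ℝ → ℤ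
  | 0, ξ => ⌊ξ⌋
  | n + 1, ξ => cfA n (ξ - ⌊ξ⌋)⁻¹

/-- A Fibonacci sequence of words (indices from 1). -/
def FibWordSeq {α : Type} (w : ℕ → List α) : Prop := ∀ i, 1 ≤ i → w (i + 2) = w (i + 1) ++ w i

/-- `b` (indexed from 1: the limit word is b₁b₂b₃…) is the infinite limit word of the
sequence of words `w`: every `w k` (k ≥ 2) is a prefix of it, and their lengths are unbounded. -/
def IsLimitWord {α : Type} (w : ℕ → List α) (b : ℕ → α) : Prop :=
  (∀ n : ℕ, ∃ k, 2 ≤ k ∧ n ≤ (w k).length) ∧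
  ∀ k, 2 ≤ k → ∀ j, (h : j < (w k).length) → (w k).get ⟨j, h⟩ = b (j + 1)

/-- The Fibonacci sequence of words over the alphabet E = {a, b} (with `b = false`,
`a = true`): w₁ = b, w₂ = a, w_{k+2} = w_{k+1} w_k.  Its limit is f_{a,b}. -/
def fw : ℕ → List Bool
  | 0 => []
  | 1 => [false]
  | 2 => [true]
  | n + 3 => fw (n + 2) ++ fw (n + 1)

/-- The prefix of length `i` of the infinite Fibonacci word `f_{a,b}`
(note `fw (i+2)` is a prefix of `f_{a,b}` of length ≥ i). -/
def fpref (i : ℕ) : List Bool := (fw (i + 2)).take i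

/-- The monoid morphism Φ : E* → (𝒫, *) with Φ(b) = W₁, Φ(a) = W₂
(the letter `b` is `false` and `a` is `true`). -/
def PhiW (W1 W2 : M2) : List Bool → M2
  | [] => 1
  | x :: u => pmul (if x then W2 else W1) (PhiW W1 W2 u)

/-- The set 𝒮₁ of real matrices (a b; c d) with a ≥ max{b,c} and min{b,c} ≥ d ≥ 0. -/
def S1 : Set (Matrix (Fin 2) (Fin 2) ℝ) :=
  {A | max (A 0 1) (A 1 0) ≤ A 0 0 ∧ A 1 1 ≤ min (A 0 1) (A 1 0) ∧ 0 ≤ A 1 1}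

/-- The set 𝒮 = 𝒮₁ ∩ GL₂(ℤ), viewed as a set of integer matrices. -/
def Sset : Set M2 :=
  {A | (A.map (Int.cast : ℤ → ℝ)) ∈ S1 ∧ (A.det = 1 ∨ A.det = -1)}

/-- ξ is an extremal real number with an associated Fibonacci sequence in GL₂(ℤ). -/
def HasGLAssoc (ξ : ℝ) : Prop :=
  IsExtremal ξ ∧ ∃ W : ℕ → M2, IsAssociated ξ W ∧ ∀ i, 1 ≤ i → InGL2Z (W i)

/-- ξ is an extremal real number with an associated Fibonacci sequence in 𝒮. -/
def HasSAssoc (ξ : ℝ) : Prop :=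
  IsExtremal ξ ∧ ∃ W : ℕ → M2, IsAssociated ξ W ∧ ∀ i, 1 ≤ i → W i ∈ Sset

/-- The determinant of the 3×3 matrix whose rows list the coefficients of three symmetric
2×2 matrices. -/
def tripleDet (A B C : M2) : ℤ :=
  A 0 0 * (B 0 1 * C 1 1 - B 1 1 * C 0 1) - B 0 0 * (A 0 1 * C 1 1 - A 1 1 * C 0 1)
    + C 0 0 * (A 0 1 * B 1 1 - A 1 1 * B 0 1)

/-- `A` has norm `O(a)`, and `(ξ, -1) A` has norm `O(1 / a)`, both with constant `C`. -/
def HasSize (ξ C a : ℝ) (A : M2) : Prop :=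
  |(A 0 0 : ℝ)| ≤ C * a ∧ |ξ * (A 0 0 : ℝ) - (A 1 0 : ℝ)| ≤ C * a⁻¹ ∧
    |ξ * (A 0 1 : ℝ) - (A 1 1 : ℝ)| ≤ C * a⁻¹

lemma ext_of_isSymm {A B : M2} (hA : A.IsSymm) (hB : B.IsSymm) (h₀ : A 0 0 = B 0 0)
    (h₁ : A 0 1 = B 0 1) (h₂ : A 1 1 = B 1 1) : A = B := by
  have hA' := hA.apply 0 1
  have hB' := hB.apply 0 1
  ext i j
  fin_cases i <;> fin_cases j <;> simp_all

/-- Cramer's rule. -/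
lemma smul_eq_smul_of_tripleDet {A B C Y : M2} (hB : B.IsSymm) (hY : Y.IsSymm)
    (h₁ : tripleDet A B Y = 0) (h₂ : tripleDet B C Y = 0) :
    tripleDet A B C • Y = tripleDet A Y C • B := by
  refine ext_of_isSymm (hY.smul _) (hB.smul _) ?_ ?_ ?_ <;>
    simp only [tripleDet, Matrix.smul_apply, smul_eq_mul] at *
  · linear_combination (A 0 0) * h₂ + (C 0 0) * h₁
  · linear_combination (A 0 1) * h₂ + (C 0 1) * h₁
  · linear_combination (A 1 1) * h₂ + (C 1 1) * h₁

lemma exists_smul_eq_smul {A B C Y : M2} (hB : B.IsSymm) (hY : Y.IsSymm) (hY0 : Y ≠ 0)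
    (h : tripleDet A B C ≠ 0) (h₁ : tripleDet A B Y = 0) (h₂ : tripleDet B C Y = 0) :
    ∃ s t : ℤ, s ≠ 0 ∧ t ≠ 0 ∧ s • Y = t • B := by
  refine ⟨_, _, h, ?_, smul_eq_smul_of_tripleDet hB hY h₁ h₂⟩
  intro h0
  have := smul_eq_smul_of_tripleDet hB hY h₁ h₂
  rw [h0, zero_smul] at this
  exact (smul_ne_zero h hY0) this

lemma eq_zero_of_tripleDet {A B C D Y : M2} (hB : B.IsSymm) (hC : C.IsSymm) (hY : Y.IsSymm)
    (h : tripleDet A B C ≠ 0) (h' : tripleDet B C D ≠ 0) (h₁ : tripleDet A B Y = 0)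
    (h₂ : tripleDet B C Y = 0) (h₃ : tripleDet C D Y = 0) : Y = 0 := by
  by_contra hY0
  obtain ⟨s, t, hs, ht, e⟩ := exists_smul_eq_smul hB hY hY0 h h₁ h₂
  have e' := smul_eq_smul_of_tripleDet hC hY h₂ h₃
  have key : ∀ i j, tripleDet B C D * t * B i j = s * tripleDet B Y D * C i j := by
    intro i j
    have e1 := congrFun (congrFun e i) j
    have e2 := congrFun (congrFun e' i) j
    simp only [Matrix.smul_apply, smul_eq_mul] at e1 e2
    linear_combination s * e2 - tripleDet B C D * e1
  have : tripleDet B C D * t * tripleDet A B C = 0 := by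
    have a := key 0 0
    have b := key 0 1
    have c := key 1 1
    generalize tripleDet B C D * t = p at *
    generalize s * tripleDet B Y D = q at *
    simp only [tripleDet]
    linear_combination (-(A 0 1 * C 1 1 - A 1 1 * C 0 1)) * a
      + (A 0 0 * C 1 1 - A 1 1 * C 0 0) * b
      + (-(A 0 0 * C 0 1) + A 0 1 * C 0 0) * c
  exact (mul_ne_zero (mul_ne_zero h' ht) h) this

lemma tripleDet_identity {a b c d p q r s x y z : ℤ} (h₁ : c * x + d * y = a * y + b * z)
    (h₂ : c * p + d * r = a * q + b * s) :
    x * ((a * q + b * s) * (c * y + d * z) - (c * q + d * s) * (a * y + b * z))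
      - (a * p + b * r) * (y * (c * y + d * z) - z * (a * y + b * z))
      + (a * x + b * y) * (y * (c * q + d * s) - z * (a * q + b * s))
      = (a * d - b * c) * (x * z - y * y) * (q - r) := by
  grobner

lemma tripleDet_ne_zero {V M x y z : M2} {m : ℤ} (hy : V * M = y)
    (hz : V * x = m • z) (sx : x.IsSymm) (sy : y.IsSymm) (sz : z.IsSymm)
    (hV : V.det ≠ 0) (hdx : x.det ≠ 0) (hM : M ≠ Mᵀ) : tripleDet x y z ≠ 0 := by
  have hM' : M 0 1 - M 1 0 ≠ 0 := by
    intro h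
    apply hM
    ext i j
    fin_cases i <;> fin_cases j <;> simp <;> lia
  have e : ∀ i j, V i 0 * x 0 j + V i 1 * x 1 j = m * z i j := by
    intro i j
    have := congrFun (congrFun hz i) j
    simpa [Matrix.mul_apply, Fin.sum_univ_two] using this
  have f : ∀ i j, V i 0 * M 0 j + V i 1 * M 1 j = y i j := by
    intro i j
    have := congrFun (congrFun hy i) j
    simpa [Matrix.mul_apply, Fin.sum_univ_two] using this
  have hx := sx.apply 0 1
  have hy := sy.apply 0 1
  have hz := sz.apply 0 1
  have e00 := e 0 0
  have e01 := e 0 1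
  have e10 := e 1 0
  have e11 := e 1 1
  have f00 := f 0 0
  have f01 := f 0 1
  have f10 := f 1 0
  have f11 := f 1 1
  rw [hz] at e10
  rw [hx] at e10 e00
  rw [hy] at f10
  rw [Matrix.det_fin_two] at hV hdx
  rw [hx] at hdx
  have : m * tripleDet x y z = (V 0 0 * V 1 1 - V 0 1 * V 1 0) * (x 0 0 * x 1 1 - x 0 1 * x 0 1)
      * (M 0 1 - M 1 0) := by
    rw [← tripleDet_identity (e10.trans e01.symm) (f10.trans f01.symm)]
    simp only [tripleDet]
    rw [f01, f11, f00]
    linear_combination (x 0 0 * y 1 1 - y 0 0 * x 1 1) * e01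
      - (x 0 0 * y 0 1 - y 0 0 * x 0 1) * e11 - (x 0 1 * y 1 1 - x 1 1 * y 0 1) * e00
  intro h0
  rw [h0, mul_zero] at this
  exact mul_ne_zero (mul_ne_zero hV hdx) hM' this.symm

lemma tripleDet_eq_zero_of_hasSize {ξ C a b c : ℝ} {x y z : M2} (sx : x.IsSymm) (sy : y.IsSymm)
    (sz : z.IsSymm) (ha : 0 < a) (hb : 0 < b) (hc : 0 < c) (hx : HasSize ξ C a x)
    (hy : HasSize ξ C b y) (hz : HasSize ξ C c z) (h₁ : 6 * C ^ 3 * a < b * c)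
    (h₂ : 6 * C ^ 3 * b < a * c) (h₃ : 6 * C ^ 3 * c < a * b) : tripleDet x y z = 0 := by
  have sx' := sx.apply 0 1
  have sy' := sy.apply 0 1
  have sz' := sz.apply 0 1
  obtain ⟨x0, x1, x2⟩ := hx
  obtain ⟨y0, y1, y2⟩ := hy
  obtain ⟨z0, z1, z2⟩ := hz
  rw [sx'] at x1
  rw [sy'] at y1
  rw [sz'] at z1
  have key : ∀ {p q r u s : ℝ} {a b c : ℝ}, 0 < a → 0 < b → 0 < c →
      |u| ≤ C * a → |p| ≤ C * b⁻¹ → |q| ≤ C * b⁻¹ → |r| ≤ C * c⁻¹ → |s| ≤ C * c⁻¹ →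
      6 * C ^ 3 * a < b * c → |u * (p * s - q * r)| < 1 / 3 := by
    intro p q r u s a b c ha hb hc hu hp hq hr hs h
    have h1 : |p * s - q * r| ≤ 2 * (C * b⁻¹ * (C * c⁻¹)) := by
      have e1 : |p * s| ≤ C * b⁻¹ * (C * c⁻¹) := by
        rw [abs_mul]
        exact mul_le_mul hp hs (abs_nonneg _) ((abs_nonneg _).trans hp)
      have e2 : |q * r| ≤ C * b⁻¹ * (C * c⁻¹) := by
        rw [abs_mul]
        exact mul_le_mul hq hr (abs_nonneg _) ((abs_nonneg _).trans hq)
      linarith [abs_sub (p * s) (q * r)]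
    rw [abs_mul]
    refine (mul_le_mul hu h1 (abs_nonneg _) ((abs_nonneg _).trans hu)).trans_lt ?_
    have e : C * a * (2 * (C * b⁻¹ * (C * c⁻¹))) = (6 * C ^ 3 * a) / (b * c) / 3 := by
      field_simp
      ring
    rw [e]
    have := (div_lt_one (mul_pos hb hc)).2 h
    linarith
  have e : ((tripleDet x y z : ℤ) : ℝ) =
      x 0 0 * ((ξ * y 0 0 - y 0 1) * (ξ * z 0 1 - z 1 1)
        - (ξ * y 0 1 - y 1 1) * (ξ * z 0 0 - z 0 1))
      - y 0 0 * ((ξ * x 0 0 - x 0 1) * (ξ * z 0 1 - z 1 1)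
        - (ξ * x 0 1 - x 1 1) * (ξ * z 0 0 - z 0 1))
      + z 0 0 * ((ξ * x 0 0 - x 0 1) * (ξ * y 0 1 - y 1 1)
        - (ξ * x 0 1 - x 1 1) * (ξ * y 0 0 - y 0 1)) := by
    simp only [tripleDet]
    push_cast
    ring
  have k1 := key ha hb hc x0 y1 y2 z1 z2 h₁
  have k2 := key hb ha hc y0 x1 x2 z1 z2 h₂
  have k3 := key hc ha hb z0 x1 x2 y1 y2 h₃
  have : |((tripleDet x y z : ℤ) : ℝ)| < 1 := by
    rw [e]
    rw [abs_lt] at *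
    constructor <;> linarith
  rw [← Int.cast_abs] at this
  exact Int.abs_lt_one_iff.1 (by exact_mod_cast this)

lemma content_smul (k : ℤ) (A : M2) : content (k • A) = k.natAbs * content A := by
  simp [content, Int.natAbs_mul, Nat.gcd_mul_left]

lemma content_smul_red (A : M2) : (content A : ℤ) • red A = A := by
  have h : ∀ i j, (content A : ℤ) ∣ A i j := by
    intro i j
    rw [Int.natCast_dvd]
    fin_cases i <;> fin_cases j
    · exact (Nat.gcd_dvd_left _ _).trans (Nat.gcd_dvd_left _ _)
    · exact (Nat.gcd_dvd_left _ _).trans (Nat.gcd_dvd_right _ _)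
    · exact (Nat.gcd_dvd_right _ _).trans (Nat.gcd_dvd_left _ _)
    · exact (Nat.gcd_dvd_right _ _).trans (Nat.gcd_dvd_right _ _)
  ext i j
  simpa [red] using Int.mul_ediv_cancel' (h i j)

lemma Primitive.ne_zero {A : M2} (hA : Primitive A) : A ≠ 0 := by
  rintro rfl
  simp [Primitive, content] at hA

lemma Primitive.eq_or_eq_neg {A B : M2} (hA : Primitive A) (hB : Primitive B) {a b : ℤ}
    (ha : a ≠ 0) (h : a • A = b • B) : ∃ e : ℤ, (e = 1 ∨ e = -1) ∧ A = e • B := by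
  have hab : a.natAbs = b.natAbs := by
    have := congrArg content h
    rwa [content_smul, content_smul, show content A = 1 from hA, show content B = 1 from hB,
      mul_one, mul_one] at this
  rcases Int.natAbs_eq_natAbs_iff.1 hab with rfl | rfl
  · exact ⟨1, .inl rfl, by simpa using smul_right_injective _ ha h⟩
  · refine ⟨-1, .inr rfl, smul_right_injective _ ha ?_⟩
    simp only [smul_smul, h]
    congr 1
    ring

lemma abs_le_mnorm (A : M2) (i j : Fin 2) : |(A i j : ℝ)| ≤ mnorm A := by
  fin_cases i <;> fin_cases j <;> simp [mnorm]

lemma one_le_mnorm {A : M2} (hA : A ≠ 0) : 1 ≤ mnorm A := by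
  by_contra hlt
  apply hA
  ext i j
  have := (abs_le_mnorm A i j).trans_lt (not_le.1 hlt)
  exact Int.abs_lt_one_iff.1 (by exact_mod_cast this)

lemma HasSize.mono {ξ C C' a : ℝ} {A : M2} (h : HasSize ξ C a A) (ha : 0 < a) (hC : C ≤ C') :
    HasSize ξ C' a A := by
  have h1 : C * a ≤ C' * a := by gcongr
  have h2 : C * a⁻¹ ≤ C' * a⁻¹ := by gcongr
  exact ⟨h.1.trans h1, h.2.1.trans h2, h.2.2.trans h2⟩

lemma hasSize_mul {ξ c : ℝ} {V : M2} (N : M2) (hV : 0 < mnorm V) (hc : 1 ≤ c)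
    (h : xiNorm ξ V ≤ c * (mnorm V)⁻¹) : HasSize ξ (2 * mnorm N * c) (mnorm V) (V * N) := by
  have key : ∀ {p q r s x y : ℝ}, |p| ≤ x → |q| ≤ x → |r| ≤ y → |s| ≤ y →
      |p * r + q * s| ≤ 2 * y * x := by
    intro p q r s x y hp hq hr hs
    have h1 : |p * r| ≤ x * y := by
      rw [abs_mul]
      exact mul_le_mul hp hr (abs_nonneg _) ((abs_nonneg _).trans hp)
    have h2 : |q * s| ≤ x * y := by
      rw [abs_mul]
      exact mul_le_mul hq hs (abs_nonneg _) ((abs_nonneg _).trans hq)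
    linarith [abs_add_le (p * r) (q * s)]
  have hN : 0 ≤ mnorm N := (abs_nonneg _).trans (abs_le_mnorm N 0 0)
  have hx0 := (le_max_left _ _).trans h
  have hx1 := (le_max_right _ _).trans h
  simp only [HasSize, Matrix.mul_apply, Fin.sum_univ_two, Int.cast_add, Int.cast_mul]
  refine ⟨?_, ?_, ?_⟩
  · refine (key (abs_le_mnorm V 0 0) (abs_le_mnorm V 0 1) (abs_le_mnorm N 0 0)
      (abs_le_mnorm N 1 0)).trans ?_
    exact mul_le_mul_of_nonneg_right (le_mul_of_one_le_right (by positivity) hc) hV.le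
  · convert key hx0 hx1 (abs_le_mnorm N 0 0) (abs_le_mnorm N 1 0) using 1
    · congr 1
      ring
    · ring
  · convert key hx0 hx1 (abs_le_mnorm N 0 1) (abs_le_mnorm N 1 1) using 1
    · congr 1
      ring
    · ring

/-- `X i ≥ 1` is unbounded and `X (i + 1)` is comparable to `X i` to the power of the golden
ratio. -/
structure GoldenGrowth (X : ℕ → ℝ) (c : ℝ) : Prop where
  one_le : ∀ i, 1 ≤ X i
  one_le_const : 1 ≤ c
  rpow_le : ∀ i, X i ^ gam ≤ c * X (i + 1)
  le_rpow : ∀ i, X (i + 1) ≤ c * X i ^ gam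
  unbounded : ∀ B, ∃ i, B < X i

lemma gam_gt_one : 1 < gam := by
  have : 1 < √5 := Real.lt_sqrt_of_sq_lt (by norm_num)
  unfold gam
  linarith

lemma gam_mul : gam * (gam - 1) = 1 := by
  have := Real.sq_sqrt (show (0 : ℝ) ≤ 5 by norm_num)
  unfold gam
  linarith

namespace GoldenGrowth

open Filter

variable {X : ℕ → ℝ} {c : ℝ}

lemma pos (h : GoldenGrowth X c) (i : ℕ) : 0 < X i := one_pos.trans_le (h.one_le i)

lemma tendsto (h : GoldenGrowth X c) : Tendsto X atTop atTop := by
  have hg : 0 < gam - 1 := by linarith [gam_gt_one]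
  have hc := h.one_le_const
  obtain ⟨i, hi⟩ := h.unbounded ((2 * c) ^ (gam - 1)⁻¹)
  have key : ∀ n, (2 * c) ^ (gam - 1)⁻¹ < X n → 2 * X n ≤ X (n + 1) := by
    intro n hn
    have h1 : 2 * c ≤ X n ^ (gam - 1) := by
      have := Real.rpow_le_rpow (by positivity) hn.le hg.le
      rwa [← Real.rpow_mul (by positivity), inv_mul_cancel₀ hg.ne', Real.rpow_one] at this
    have h2 : X n ^ gam = X n ^ (gam - 1) * X n := by
      rw [← Real.rpow_add_one (h.pos n).ne', sub_add_cancel]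
    have h3 := h.rpow_le n
    rw [h2] at h3
    have h4 : c * (2 * X n) ≤ c * X (n + 1) := by nlinarith [h.pos n]
    exact le_of_mul_le_mul_left h4 (by linarith)
  have main : ∀ n, (2 * c) ^ (gam - 1)⁻¹ < X (n + i) ∧ 2 ^ n ≤ X (n + i) := by
    intro n
    induction n with
    | zero => simpa using ⟨hi, h.one_le i⟩
    | succ n ih =>
      have := key _ ih.1
      rw [show n + 1 + i = n + i + 1 by ring, pow_succ]
      constructor <;> linarith [h.pos (n + i), ih.1, ih.2]
  rw [← tendsto_add_atTop_iff_nat i]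
  exact tendsto_atTop_mono (fun n => (main n).2) (tendsto_pow_atTop_atTop_of_one_lt (by norm_num))

lemma exists_fib (h : GoldenGrowth X c) : ∃ A, 1 ≤ A ∧ ∀ i, X (i + 2) ≤ A * (X (i + 1) * X i) ∧
    X (i + 1) * X i ≤ A * X (i + 2) := by
  have hg : 0 < gam - 1 := by linarith [gam_gt_one]
  have hc := h.one_le_const
  have hc' : 1 ≤ c ^ (gam - 1) := Real.one_le_rpow hc hg.le
  refine ⟨c * c ^ (gam - 1), one_le_mul_of_one_le_of_one_le hc hc', fun i => ?_⟩
  have hp := h.pos i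
  have hp' := h.pos (i + 1)
  have h0 : (X i ^ gam) ^ (gam - 1) = X i := by
    rw [← Real.rpow_mul hp.le, gam_mul, Real.rpow_one]
  have h1 : X (i + 1) ^ gam = X (i + 1) * X (i + 1) ^ (gam - 1) := by
    rw [mul_comm, ← Real.rpow_add_one hp'.ne', sub_add_cancel]
  have h2 : X (i + 1) ^ (gam - 1) ≤ c ^ (gam - 1) * X i := by
    have := Real.rpow_le_rpow hp'.le (h.le_rpow i) hg.le
    rwa [Real.mul_rpow (by linarith) (by positivity), h0] at this
  have h3 : X i ≤ c ^ (gam - 1) * X (i + 1) ^ (gam - 1) := by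
    have := Real.rpow_le_rpow (by positivity) (h.rpow_le i) hg.le
    rwa [Real.mul_rpow (by linarith) (by positivity), h0] at this
  constructor
  · calc X (i + 2) ≤ c * X (i + 1) ^ gam := h.le_rpow (i + 1)
      _ ≤ c * (X (i + 1) * (c ^ (gam - 1) * X i)) := by rw [h1]; gcongr
      _ = _ := by ring
  · calc X (i + 1) * X i ≤ X (i + 1) * (c ^ (gam - 1) * X (i + 1) ^ (gam - 1)) := by gcongr
      _ = c ^ (gam - 1) * X (i + 1) ^ gam := by rw [h1]; ring
      _ ≤ c ^ (gam - 1) * (c * X (i + 2)) := by gcongr; exact h.rpow_le (i + 1)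
      _ = _ := by ring

lemma eventually_mul_le_succ (h : GoldenGrowth X c) (M : ℝ) :
    ∀ᶠ n in atTop, M * X n ≤ X (n + 1) := by
  obtain ⟨A, hA, hX⟩ := h.exists_fib
  rw [← map_add_atTop_eq_nat 1, eventually_map]
  filter_upwards [h.tendsto.eventually_ge_atTop (A * M)] with n hn
  have h1 := (hX n).2
  have h2 : A * (M * X (n + 1)) ≤ A * X (n + 2) := by nlinarith [h.pos (n + 1)]
  exact le_of_mul_le_mul_left h2 (by linarith)

lemma eventually_mul_succ_le_sq (h : GoldenGrowth X c) (M : ℝ) :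
    ∀ᶠ n in atTop, M * X (n + 1) ≤ X n ^ 2 := by
  obtain ⟨A, hA, hX⟩ := h.exists_fib
  rw [← map_add_atTop_eq_nat 1, eventually_map]
  filter_upwards [h.eventually_mul_le_succ (|M| * A)] with n hn
  calc M * X (n + 2) ≤ |M| * (A * (X (n + 1) * X n)) := by
        gcongr
        · exact (h.pos _).le
        · exact le_abs_self M
        · exact (hX n).1
    _ = X (n + 1) * (|M| * A * X n) := by ring
    _ ≤ X (n + 1) * X (n + 1) := by gcongr; exact (h.pos _).le
    _ = _ := by ring

lemma exists_bound (X : ℕ → ℝ) (J : ℕ) : ∃ B, ∀ j, B < X j → J ≤ j := by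
  obtain ⟨B, hB⟩ := ((Finset.range J).image X).bddAbove
  refine ⟨B, fun j hj => ?_⟩
  by_contra hlt
  exact hj.not_ge (hB (by simpa using ⟨j, not_le.1 hlt, rfl⟩))

end GoldenGrowth

/-- A sequence of symmetric matrices of sizes `X i`, any three consecutive ones of which are
linearly independent. -/
structure IndepSymm (ξ C : ℝ) (X : ℕ → ℝ) (x : ℕ → M2) : Prop where
  isSymm : ∀ i, (x i).IsSymm
  indep : ∀ i, tripleDet (x i) (x (i + 1)) (x (i + 2)) ≠ 0
  hasSize : ∀ i, HasSize ξ C (X i) (x i)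

namespace IndepSymm

open Filter

variable {ξ C c : ℝ} {X : ℕ → ℝ} {x : ℕ → M2}

lemma eventually_proportional (hx : IndepSymm ξ C X x) (hX : GoldenGrowth X c) (hC : 1 ≤ C)
    {K : ℝ} (hK : 1 ≤ K) : ∀ᶠ n in atTop, ∀ (r : ℝ) (y : M2), y ≠ 0 → y.IsSymm →
      HasSize ξ C r y → r ≤ K * X (n + 1) → X (n + 1) ≤ K * r →
      ∃ s t : ℤ, s ≠ 0 ∧ t ≠ 0 ∧ s • y = t • x (n + 1) := by
  obtain ⟨M, hM⟩ : ∃ M, M = 6 * C ^ 3 := ⟨_, rfl⟩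
  have hM1 : 1 ≤ M := by
    have : 1 ≤ C ^ 3 := one_le_pow₀ hC
    linarith
  have hsucc := tendsto_add_atTop_nat 1
  filter_upwards [hX.tendsto.eventually_gt_atTop (M * K * K + 1), hX.eventually_mul_le_succ 1,
    hsucc.eventually (hX.eventually_mul_le_succ 1),
    hsucc.eventually (hX.eventually_mul_succ_le_sq (2 * M * K))] with
    n h0 h1 h2 h3 r y hy sy hr hK1 hK2
  have p0 := hX.pos n
  have p1 := hX.pos (n + 1)
  have p2 := hX.pos (n + 2)
  rw [one_mul] at h1 h2
  change X (n + 1) ≤ X (n + 2) at h2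
  change 2 * M * K * X (n + 2) ≤ X (n + 1) ^ 2 at h3
  have hMK : M ≤ M * K := le_mul_of_one_le_right (by linarith) hK
  have hMKK : M * K ≤ M * K * K := le_mul_of_one_le_right (by nlinarith) hK
  have hrM : M < r := by
    have : K * M < K * r := by nlinarith
    exact lt_of_mul_lt_mul_left this (by linarith)
  have hr0 : 0 < r := by linarith
  refine exists_smul_eq_smul (hx.isSymm _) sy hy (hx.indep n) ?_ ?_
  · refine tripleDet_eq_zero_of_hasSize (hx.isSymm _) (hx.isSymm _) sy p0 p1 hr0 (hx.hasSize _)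
      (hx.hasSize _) hr ?_ ?_ ?_ <;> rw [← hM]
    · nlinarith
    · nlinarith [mul_le_mul_of_nonneg_left hK2 (by linarith : 0 ≤ M)]
    · nlinarith [mul_le_mul_of_nonneg_left hK1 (by linarith : 0 ≤ M)]
  · refine tripleDet_eq_zero_of_hasSize (hx.isSymm _) (hx.isSymm _) sy p1 p2 hr0 (hx.hasSize _)
      (hx.hasSize _) hr ?_ ?_ ?_ <;> rw [← hM]
    · nlinarith
    · have : K * (2 * M * X (n + 2)) ≤ K * (X (n + 1) * r) := by nlinarith
      have := le_of_mul_le_mul_left this (by linarith)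
      nlinarith
    · nlinarith [mul_le_mul_of_nonneg_left hK1 (by linarith : 0 ≤ M)]

lemma eventually_comparable (hx : IndepSymm ξ C X x) (hX : GoldenGrowth X c) (hC : 1 ≤ C) :
    ∃ K, 1 ≤ K ∧ ∀ᶠ n in atTop, ∀ (r : ℝ) (y : M2), y ≠ 0 → y.IsSymm →
      HasSize ξ C r y → X (n + 1) ≤ r → r < X (n + 2) → r ≤ K * X (n + 1) ∨ X (n + 2) ≤ K * r := by
  obtain ⟨M, hM⟩ : ∃ M, M = 6 * C ^ 3 := ⟨_, rfl⟩
  have hM1 : 1 ≤ M := by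
    have : 1 ≤ C ^ 3 := one_le_pow₀ hC
    linarith
  obtain ⟨A, hA, hAX⟩ := hX.exists_fib
  refine ⟨A * M, one_le_mul_of_one_le_of_one_le hA hM1, ?_⟩
  have hsucc := tendsto_add_atTop_nat 1
  have hsucc2 := tendsto_add_atTop_nat 2
  filter_upwards [hX.tendsto.eventually_gt_atTop (M + 1), hX.eventually_mul_le_succ 1,
    hsucc.eventually (hX.eventually_mul_le_succ 1),
    hsucc2.eventually (hX.eventually_mul_le_succ 1),
    hsucc.eventually (hX.eventually_mul_succ_le_sq (2 * M))] with
    n h0 h1 h2 h2' h3 r y hy sy hr hr1 hr2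
  by_contra! hcon
  obtain ⟨hc1, hc2⟩ := hcon
  have p0 := hX.pos n
  have p1 := hX.pos (n + 1)
  have p2 := hX.pos (n + 2)
  have p3 := hX.pos (n + 3)
  rw [one_mul] at h1 h2 h2'
  change X (n + 1) ≤ X (n + 2) at h2
  change X (n + 2) ≤ X (n + 3) at h2'
  change 2 * M * X (n + 2) ≤ X (n + 1) ^ 2 at h3
  have hr0 : 0 < r := by linarith
  refine hy (eq_zero_of_tripleDet (hx.isSymm (n + 1)) (hx.isSymm (n + 2)) sy (hx.indep n)
    (hx.indep (n + 1)) ?_ ?_ (tripleDet_eq_zero_of_hasSize (y := x (n + 3)) (hx.isSymm _)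
      (hx.isSymm _) sy p2 p3 hr0 (hx.hasSize _) (hx.hasSize _) hr ?_ ?_ ?_))
  · refine tripleDet_eq_zero_of_hasSize (hx.isSymm _) (hx.isSymm _) sy p0 p1 hr0 (hx.hasSize _)
      (hx.hasSize _) hr ?_ ?_ ?_ <;> rw [← hM]
    · nlinarith
    · nlinarith
    · have : A * (M * r) < A * (X n * X (n + 1)) := by nlinarith [(hAX n).1]
      exact lt_of_mul_lt_mul_left this (by linarith)
  · refine tripleDet_eq_zero_of_hasSize (hx.isSymm _) (hx.isSymm _) sy p1 p2 hr0 (hx.hasSize _)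
      (hx.hasSize _) hr ?_ ?_ ?_ <;> rw [← hM]
    · nlinarith
    · nlinarith
    · nlinarith
  · rw [← hM]
    nlinarith
  · rw [← hM]
    calc M * X (n + 3) ≤ M * (A * (X (n + 2) * X (n + 1))) := by gcongr; exact (hAX (n + 1)).1
      _ = X (n + 2) * (A * M * X (n + 1)) := by ring
      _ < X (n + 2) * r := by gcongr
  · rw [← hM]
    nlinarith

/-- A matrix of the sizes considered is proportional to a term of the sequence of comparable
size. -/
lemma exists_proportional (hx : IndepSymm ξ C X x) (hX : GoldenGrowth X c) (hC : 1 ≤ C) :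
    ∃ K, 1 ≤ K ∧ ∀ J, ∃ R, ∀ (r : ℝ) (y : M2), R < r → y ≠ 0 → y.IsSymm → HasSize ξ C r y →
      ∃ n, J ≤ n ∧ r ≤ K * X n ∧ X n ≤ K * r ∧ ∃ s t : ℤ, s ≠ 0 ∧ t ≠ 0 ∧ s • y = t • x n := by
  obtain ⟨K, hK, h₁⟩ := hx.eventually_comparable hX hC
  refine ⟨K, hK, fun J => ?_⟩
  obtain ⟨N, hN⟩ := eventually_atTop.1 (h₁.and (hx.eventually_proportional hX hC hK))
  obtain ⟨B, hB⟩ := GoldenGrowth.exists_bound X (N + J + 2)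
  refine ⟨max B (X 0), fun r y hr hy sy hry => ?_⟩
  obtain ⟨hrB, hr0⟩ := max_lt_iff.1 hr
  have hr1 : 1 < r := (hX.one_le 0).trans_lt hr0
  have hex := hX.unbounded r
  classical
  obtain ⟨m, hm⟩ : ∃ m, Nat.find hex = m := ⟨_, rfl⟩
  have hm1 : r < X m := hm ▸ Nat.find_spec hex
  have hmJ := hB m (hrB.trans hm1)
  obtain ⟨n, rfl⟩ : ∃ n, m = n + 2 := ⟨m - 2, by lia⟩
  have hm2 : X (n + 1) ≤ r := not_lt.1 (Nat.find_min hex (by lia))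
  rcases (hN n (by lia)).1 r y hy sy hry hm2 hm1 with h | h
  · have h' : X (n + 1) ≤ K * r := hm2.trans (le_mul_of_one_le_left (by linarith) hK)
    exact ⟨n + 1, by lia, h, h', (hN n (by lia)).2 r y hy sy hry h h'⟩
  · have h' : r ≤ K * X (n + 2) := hm1.le.trans (le_mul_of_one_le_left (hX.pos _).le hK)
    exact ⟨n + 2, by lia, h', h, (hN (n + 1) (by lia)).2 r y hy sy hry h' h⟩

/-- Two sequences of symmetric matrices attached to the same number are proportional up to a
shift. -/
lemma exists_shift (hx : IndepSymm ξ C X x) (hX : GoldenGrowth X c) (hC : 1 ≤ C) {c' : ℝ}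
    {X' : ℕ → ℝ} {x' : ℕ → M2} (hx' : IndepSymm ξ C X' x') (hX' : GoldenGrowth X' c')
    (hx0 : ∀ i, x' i ≠ 0) :
    ∃ k l : ℕ, ∀ i, ∃ s t : ℤ, s ≠ 0 ∧ t ≠ 0 ∧ s • x' (i + k) = t • x (i + l) := by
  obtain ⟨K, hK, hex⟩ := hx.exists_proportional hX hC
  obtain ⟨L, hL⟩ : ∃ L, L = K * (c' * (K ^ gam * c)) := ⟨_, rfl⟩
  obtain ⟨L', hL'⟩ : ∃ L', L' = c * (K ^ gam * (c' * K)) := ⟨_, rfl⟩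
  have hg : 0 ≤ gam := by linarith [gam_gt_one]
  have hKg : 0 ≤ K ^ gam := by positivity
  have hc := hX.one_le_const
  have hc' := hX'.one_le_const
  obtain ⟨J, hJ⟩ := eventually_atTop.1 ((hX.eventually_mul_le_succ (L + 1)).and
    ((hX.eventually_mul_le_succ (L' + 1)).and (hX.eventually_mul_le_succ 1)))
  obtain ⟨R, hR⟩ := hex J
  obtain ⟨k, hk⟩ := eventually_atTop.1 (hX'.tendsto.eventually_gt_atTop R)
  have hall : ∀ i, ∃ n, J ≤ n ∧ X' (i + k) ≤ K * X n ∧ X n ≤ K * X' (i + k) ∧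
      ∃ s t : ℤ, s ≠ 0 ∧ t ≠ 0 ∧ s • x' (i + k) = t • x n := fun i =>
    hR _ _ (hk _ (by lia)) (hx0 _) (hx'.isSymm _) (hx'.hasSize _)
  choose j hj1 hj2 hj3 hj4 using hall
  have hmono : ∀ a b, J ≤ a → a ≤ b → X a ≤ X b := by
    intro a b ha hab
    induction b, hab using Nat.le_induction with
    | base => exact le_rfl
    | succ b hb ih => linarith [(hJ b (by lia)).2.2]
  have hstep : ∀ i, j (i + 1) = j i + 1 := by
    intro i
    have p := hX.pos (j i)
    have p' := hX'.pos (i + k)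
    have u1 : X (j (i + 1)) ≤ L * X (j i + 1) := by
      calc X (j (i + 1)) ≤ K * X' (i + 1 + k) := hj3 _
        _ = K * X' (i + k + 1) := by rw [add_right_comm]
        _ ≤ K * (c' * X' (i + k) ^ gam) := by gcongr; exact hX'.le_rpow _
        _ ≤ K * (c' * (K * X (j i)) ^ gam) := by gcongr; exact hj2 i
        _ = K * (c' * (K ^ gam * X (j i) ^ gam)) := by
          rw [Real.mul_rpow (by linarith) p.le]
        _ ≤ K * (c' * (K ^ gam * (c * X (j i + 1)))) := by gcongr; exact hX.rpow_le _
        _ = _ := by rw [hL]; ring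
    have u2 : X (j i + 1) ≤ L' * X (j (i + 1)) := by
      calc X (j i + 1) ≤ c * X (j i) ^ gam := hX.le_rpow _
        _ ≤ c * (K * X' (i + k)) ^ gam := by gcongr; exact hj3 i
        _ = c * (K ^ gam * X' (i + k) ^ gam) := by
          rw [Real.mul_rpow (by linarith) p'.le]
        _ ≤ c * (K ^ gam * (c' * X' (i + k + 1))) := by gcongr; exact hX'.rpow_le _
        _ ≤ c * (K ^ gam * (c' * (K * X (j (i + 1))))) := by
          rw [add_right_comm]; gcongr; exact hj2 (i + 1)
        _ = _ := by rw [hL']; ring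
    have hL'0 : 0 ≤ L' := by rw [hL']; positivity
    rcases lt_trichotomy (j (i + 1)) (j i + 1) with h | h | h
    · have h1 := hmono (j (i + 1)) (j i) (hj1 _) (by lia)
      have h2 := (hJ (j i) (hj1 _)).2.1
      nlinarith
    · exact h
    · have h1 := hmono (j i + 2) (j (i + 1)) (by have := hj1 i; lia) (by lia)
      have h2 := (hJ (j i + 1) (by have := hj1 i; lia)).1
      nlinarith [hX.pos (j i + 1)]
  have hji : ∀ i, j i = i + j 0 := by
    intro i
    induction i with
    | zero => simp
    | succ i ih => rw [hstep, ih]; ring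
  exact ⟨k, j 0, fun i => hji i ▸ hj4 i⟩

end IndepSymm

lemma IsFibP.mul_eq {W : ℕ → M2} (h : IsFibP W) {i : ℕ} (hi : 1 ≤ i) :
    ∃ m : ℤ, 0 < m ∧ W (i + 1) * W i = m • W (i + 2) := by
  refine ⟨content (W (i + 1) * W i), ?_, ?_⟩
  · have h0 : content (W (i + 1) * W i) ≠ 0 := by
      intro h0
      have h1 := content_smul_red (W (i + 1) * W i)
      rw [h0, Nat.cast_zero, zero_smul] at h1
      have h2 := congrArg Matrix.det h1
      rw [Matrix.det_zero, Matrix.det_mul] at h2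
      exact mul_ne_zero (h.1 (i + 1) (by lia)).2 (h.1 i hi).2 h2.symm
    exact_mod_cast Nat.pos_of_ne_zero h0
  · rw [h.2 i hi]
    exact (content_smul_red _).symm

lemma IsAssociated.goldenGrowth {ξ : ℝ} {W : ℕ → M2} (h : IsAssociated ξ W) :
    ∃ c, GoldenGrowth (fun i => mnorm (W (i + 1))) c := by
  obtain ⟨hF, hU, -, c₁, c₂, _, _, _, _, h₁, _, _, _, _, _, hc⟩ := h
  refine ⟨max 1 (max c₁⁻¹ c₂), fun i => one_le_mnorm (hF.1 _ (by lia)).1.ne_zero,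
    le_max_left _ _, fun i => ?_, fun i => ?_, fun B => ?_⟩
  · have h0 : 0 ≤ mnorm (W (i + 1 + 1)) := (abs_nonneg _).trans (abs_le_mnorm _ 0 0)
    calc mnorm (W (i + 1)) ^ gam = c₁⁻¹ * (c₁ * mnorm (W (i + 1)) ^ gam) := by field_simp
      _ ≤ c₁⁻¹ * mnorm (W (i + 1 + 1)) := by gcongr; exact (hc (i + 1) (by lia)).1
      _ ≤ _ := by gcongr; exact (le_max_left _ _).trans (le_max_right _ _)
  · have h0 : 0 ≤ mnorm (W (i + 1)) := (abs_nonneg _).trans (abs_le_mnorm _ 0 0)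
    refine (hc (i + 1) (by lia)).2.1.trans ?_
    gcongr
    exact (le_max_right _ _).trans (le_max_right _ _)
  · obtain ⟨i, hi, hB⟩ := hU B
    exact ⟨i - 1, by rwa [Nat.sub_add_cancel hi]⟩

lemma IsAssociated.exists_indepSymm {ξ : ℝ} {W : ℕ → M2} (h : IsAssociated ξ W) :
    ∃ (x : ℕ → M2) (C : ℝ), IndepSymm ξ C (fun i => mnorm (W (i + 1))) x ∧
      (∀ i, (x i).det ≠ 0) ∧ ∀ i, ∃ m : ℤ, m ≠ 0 ∧ W (i + 2) * x i = m • x (i + 2) := by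
  obtain ⟨hF, -, ⟨N, hN, hN', -, hsymm⟩, _, _, _, c₄, _, _, _, _, _, _, _, _, hc⟩ := h
  obtain ⟨P, hP⟩ : ∃ P : ℕ → M2, P = fun i => if i % 2 = 1 then Nᵀ else N := ⟨_, rfl⟩
  have hP1 : ∀ i, P (i + 1) = (P i)ᵀ := by
    intro i
    rcases Nat.mod_two_eq_zero_or_one i with h | h <;> simp [hP, h, Nat.add_mod]
  have hP2 : ∀ i, P (i + 2) = P i := fun i => by
    rw [hP1, hP1, Matrix.transpose_transpose]
  have hPs : ∀ i, P i = N ∨ P i = Nᵀ := by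
    intro i
    simp only [hP]
    split_ifs <;> simp
  have hPn : ∀ i, P i ≠ (P i)ᵀ := by
    intro i
    rcases hPs i with h | h <;> rw [h]
    · exact hN'
    · rw [Matrix.transpose_transpose]
      exact hN'.symm
  have hdet : ∀ i, (P i).det ≠ 0 := by
    intro i
    rcases hPs i with h | h <;> rw [h]
    · exact hN.2
    · rw [Matrix.det_transpose]
      exact hN.2
  have hs : ∀ i, (W (i + 1) * P (i + 1)).IsSymm := by
    intro i
    simpa only [hP] using hsymm (i + 1) (by lia)
  have hd : ∀ i, (W (i + 1) * P (i + 1)).det ≠ 0 := by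
    intro i
    rw [Matrix.det_mul]
    exact mul_ne_zero (hF.1 _ (by lia)).2 (hdet _)
  have hrec : ∀ i, ∃ m : ℤ, m ≠ 0 ∧
      W (i + 2) * (W (i + 1) * P (i + 1)) = m • (W (i + 3) * P (i + 3)) := by
    intro i
    obtain ⟨m, hm, e⟩ := hF.mul_eq (i := i + 1) (by lia)
    refine ⟨m, hm.ne', ?_⟩
    rw [← Matrix.mul_assoc, show P (i + 3) = P (i + 1) from hP2 (i + 1), ← Matrix.smul_mul]
    exact congrArg (· * P (i + 1)) e
  have hpos : ∀ i, 0 < mnorm (W (i + 1)) := fun i =>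
    one_pos.trans_le (one_le_mnorm (hF.1 _ (by lia)).1.ne_zero)
  refine ⟨fun i => W (i + 1) * P (i + 1),
    max (2 * mnorm N * max 1 c₄) (2 * mnorm Nᵀ * max 1 c₄),
    ⟨hs, fun i => ?_, fun i => ?_⟩, hd, hrec⟩
  · obtain ⟨m, -, e⟩ := hrec i
    exact tripleDet_ne_zero (V := W (i + 2)) (M := P (i + 2)) rfl e (hs i) (hs (i + 1))
      (hs (i + 2)) (hF.1 _ (by lia)).2 (hd i) (hPn _)
  · have hb : xiNorm ξ (W (i + 1)) ≤ max 1 c₄ * (mnorm (W (i + 1)))⁻¹ := by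
      refine (hc (i + 1) (by lia)).2.2.2.1.trans ?_
      have := hpos i
      gcongr
      exact le_max_right _ _
    have := hasSize_mul (P (i + 1)) (hpos i) (le_max_left _ _) hb
    refine this.mono (hpos i) ?_
    rcases hPs (i + 1) with h | h <;> rw [h]
    · exact le_max_left _ _
    · exact le_max_right _ _

lemma IndepSymm.mono {ξ C C' : ℝ} {X : ℕ → ℝ} {x : ℕ → M2} (h : IndepSymm ξ C X x)
    (hX : ∀ i, 0 < X i) (hC : C ≤ C') : IndepSymm ξ C' X x :=
  ⟨h.isSymm, h.indep, fun i => (h.hasSize i).mono (hX i) hC⟩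

/-- Two nonzero multiples of a matrix are transformed by `V` and `V'` into nonzero multiples of
a common matrix only if `V` and `V'` are proportional. -/
lemma exists_smul_eq_smul_of_mul {V V' x x' y y' : M2} {m m' s t u v : ℤ} (hd : x.det ≠ 0)
    (e : V * x = m • y) (e' : V' * x' = m' • y') (hxy : s • x' = t • x) (huv : u • y' = v • y)
    (hm : m ≠ 0) (ht : t ≠ 0) (hu : u ≠ 0) :
    ∃ a b : ℤ, a ≠ 0 ∧ a • V' = b • V := by
  refine ⟨t * u * m * x.det, s * m' * v * x.det,
    mul_ne_zero (mul_ne_zero (mul_ne_zero ht hu) hm) hd, ?_⟩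
  have h1 : (t * u * m) • (V' * x) = (s * m' * v) • (V * x) := by
    calc (t * u * m) • (V' * x) = (u * m) • (V' * (t • x)) := by
          rw [Matrix.mul_smul, smul_smul]; congr 1; ring
      _ = (s * m' * m) • (u • y') := by
          rw [← hxy, Matrix.mul_smul, e', smul_smul, smul_smul, smul_smul]; congr 1; ring
      _ = (s * m' * v) • (V * x) := by
          rw [huv, e, smul_smul, smul_smul]; congr 1; ring
  have h2 := congrArg (· * x.adjugate) h1
  simpa only [Matrix.smul_mul, Matrix.mul_assoc, Matrix.mul_adjugate, Matrix.mul_smul,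
    Matrix.mul_one, smul_smul] using h2

/-- Signs relating two Fibonacci sequences form a Fibonacci sequence. -/
lemma sign_mul_eq {A B C A' B' C' : M2} {m m' a b c : ℤ} (hm : 0 < m) (hm' : 0 < m')
    (hC : C ≠ 0) (e : B * A = m • C) (e' : B' * A' = m' • C') (ha : A' = a • A) (hb : B' = b • B)
    (hc : C' = c • C) (ha1 : a = 1 ∨ a = -1) (hb1 : b = 1 ∨ b = -1) (hc1 : c = 1 ∨ c = -1) :
    c = b * a := by
  have h : (b * a * m) • C = (m' * c) • C := by
    calc (b * a * m) • C = (b * a) • (B * A) := by rw [e, smul_smul]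
      _ = B' * A' := by rw [ha, hb, Matrix.smul_mul, Matrix.mul_smul, smul_smul]
      _ = (m' * c) • C := by rw [e', hc, smul_smul]
  have h' := smul_left_injective ℤ hC h
  rcases ha1 with rfl | rfl <;> rcases hb1 with rfl | rfl <;> rcases hc1 with rfl | rfl <;>
    simp at h' ⊢ <;> lia

/-- Two Fibonacci sequences associated to the same extremal real number ξ coincide up to
shifts of indices and up to term-by-term multiplication by a Fibonacci sequence in {±1}. -/
theorem stmt1 (ξ : ℝ) (hξ : IsExtremal ξ) (W W' : ℕ → M2)
    (hW : IsAssociated ξ W) (hW' : IsAssociated ξ W') :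
    ∃ (k l i₀ : ℕ) (ε : ℕ → ℤ), 1 ≤ i₀ ∧
      (∀ i, 1 ≤ i → ε i = 1 ∨ ε i = -1) ∧
      (∀ i, 1 ≤ i → ε (i + 2) = ε (i + 1) * ε i) ∧
      (∀ i, i₀ ≤ i → W' (i + k) = ε i • W (i + l)) := by
  obtain ⟨c, hX⟩ := hW.goldenGrowth
  obtain ⟨c', hX'⟩ := hW'.goldenGrowth
  obtain ⟨x, C, hx, hd, hr⟩ := hW.exists_indepSymm
  obtain ⟨x', C', hx', hd', hr'⟩ := hW'.exists_indepSymm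
  have hx0 : ∀ i, x' i ≠ 0 := fun i h0 => hd' i (by rw [h0, Matrix.det_zero])
  have hC1 : C ≤ max 1 (max C C') := (le_max_left _ _).trans (le_max_right _ _)
  have hC2 : C' ≤ max 1 (max C C') := (le_max_right _ _).trans (le_max_right _ _)
  obtain ⟨k, l, hkl⟩ := (hx.mono hX.pos hC1).exists_shift hX (le_max_left _ _)
    (hx'.mono hX'.pos hC2) hX' hx0
  have hsign : ∀ i, ∃ e : ℤ, (e = 1 ∨ e = -1) ∧ W' (i + (k + 2)) = e • W (i + (l + 2)) := by
    intro i
    obtain ⟨s, t, hs, ht, e₁⟩ := hkl i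
    obtain ⟨u, v, hu, hv, e₂⟩ := hkl (i + 2)
    obtain ⟨m, hm, e₃⟩ := hr (i + l)
    obtain ⟨m', hm', e₄⟩ := hr' (i + k)
    rw [add_right_comm i 2 k, add_right_comm i 2 l] at e₂
    obtain ⟨a, b, ha, e₅⟩ := exists_smul_eq_smul_of_mul (hd _) e₃ e₄ e₁ e₂ hm ht hu
    exact (hW'.1.1 _ (by lia)).1.eq_or_eq_neg (hW.1.1 _ (by lia)).1 ha e₅
  choose ε hε hWε using hsign
  refine ⟨k + 2, l + 2, 1, ε, le_rfl, fun i _ => hε i, fun i _ => ?_, fun i _ => hWε i⟩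
  obtain ⟨m, hm, e⟩ := hW.1.mul_eq (i := i + (l + 2)) (by lia)
  obtain ⟨m', hm', e'⟩ := hW'.1.mul_eq (i := i + (k + 2)) (by lia)
  have h1 := hWε (i + 1)
  have h2 := hWε (i + 2)
  rw [add_right_comm i 1, add_right_comm i 1] at h1
  rw [add_right_comm i 2, add_right_comm i 2] at h2
  exact sign_mul_eq hm hm' (hW.1.1 _ (by lia)).1.ne_zero e e' (hWε i) h1 h2 (hε _) (hε _) (hε _)
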